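/- arXiv:1611.08827 — 3 statements merged into one kernel-verified Lean document; each statement's English description precedes it below -/
import Mathlib

section
/- Let Ω ⊆ ℍ be a symmetric slice domain and let f₁, …, fₙ : Ω → ℍ be slice regular functions with no common zeros, i.e. for every q ∈ Ω there exists ℓ with f_ℓ(q) ≠ 0. Fix I, J ∈ 𝕊 with IJ = −JI and holomorphic functions F_ℓ, G_ℓ : Ω_I → L_I with f_ℓ(z) = F_ℓ(z) + G_ℓ(z)J for all z ∈ Ω_I (ℓ = 1, …, n). Then for every z₀ ∈ Ω_I there exist an open set U ⊆ Ω_I with z₀ ∈ U, invariant under the conjugation z ↦ z̄, and holomorphic functions H_ℓ, K_ℓ : U → L_I (ℓ = 1, …, n) such that on U: Σ_{ℓ=1}^{n} (F_ℓ H_ℓ − G_ℓ K̂_ℓ) = 1 and Σ_{ℓ=1}^{n} (F_ℓ K_ℓ + G_ℓ Ĥ_ℓ) = 0. -/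
noncomputable section

/-- The 2-sphere of quaternionic imaginary units. -/
def QSphere : Set (Quaternion ℝ) := {q | q ^ 2 = -1}

/-- The complex plane `L_I = ℝ + ℝI` through an imaginary unit `I`. -/
def sliceL (I : Quaternion ℝ) : Set (Quaternion ℝ) :=
  {q | ∃ x y : ℝ, q = (x : Quaternion ℝ) + (y : Quaternion ℝ) * I}

/-- The planar parametrization of the restriction of `f` to the slice `L_I`. -/
def sliceMap (f : Quaternion ℝ → Quaternion ℝ) (I : Quaternion ℝ) : ℝ × ℝ → Quaternion ℝ :=
  fun p => f ((p.1 : Quaternion ℝ) + (p.2 : Quaternion ℝ) * I)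

/-- `f` is holomorphic (has continuous partial derivatives and satisfies
`(∂/∂x + I ∂/∂y) f = 0`) at the points of `U` lying in the slice `L_I`. -/
def HoloSlice (f : Quaternion ℝ → Quaternion ℝ) (I : Quaternion ℝ)
    (U : Set (Quaternion ℝ)) : Prop :=
  ∀ x y : ℝ, (x : Quaternion ℝ) + (y : Quaternion ℝ) * I ∈ U →
    ContDiffAt ℝ 1 (sliceMap f I) (x, y) ∧
    fderiv ℝ (sliceMap f I) (x, y) (1, 0) + I * fderiv ℝ (sliceMap f I) (x, y) (0, 1) = 0

/-- `f` is slice regular on `Ω`. -/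
def SliceRegularOn (f : Quaternion ℝ → Quaternion ℝ) (Ω : Set (Quaternion ℝ)) : Prop :=
  ∀ I ∈ QSphere, HoloSlice f I Ω

/-- `Ω` is a symmetric slice domain. -/
def IsSymmSliceDomain (Ω : Set (Quaternion ℝ)) : Prop :=
  IsOpen Ω ∧ IsConnected Ω ∧ (∃ x : ℝ, (x : Quaternion ℝ) ∈ Ω) ∧
  (∀ I ∈ QSphere, IsConnected (Ω ∩ sliceL I)) ∧
  (∀ x y : ℝ, ∀ I ∈ QSphere, (x : Quaternion ℝ) + (y : Quaternion ℝ) * I ∈ Ω →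
    ∀ J ∈ QSphere, (x : Quaternion ℝ) + (y : Quaternion ℝ) * J ∈ Ω)


/-- The identification of `ℂ` with the slice `L_I = ℝ + ℝI`: `x + yi ↦ x + yI`. -/
def toSlice (I : Quaternion ℝ) (w : ℂ) : Quaternion ℝ :=
  (w.re : Quaternion ℝ) + (w.im : Quaternion ℝ) * I

/-- The hat operation `Ĥ(z) = conj (H (z̄))`. -/
def hatC (H : ℂ → ℂ) (w : ℂ) : ℂ := starRingEnd ℂ (H (starRingEnd ℂ w))


theorem QSphere.mul_self {I : Quaternion ℝ} (hI : I ∈ QSphere) : I * I = -1 := by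
  rw [← sq]; exact hI

theorem QSphere.re_eq_zero {I : Quaternion ℝ} (hI : I ∈ QSphere) : I.re = 0 := by
  have h := QSphere.mul_self hI
  have h0 := congrArg (·.re) h
  have h1 := congrArg (·.imI) h
  have h2 := congrArg (·.imJ) h
  have h3 := congrArg (·.imK) h
  simp only [Quaternion.re_mul, Quaternion.imI_mul, Quaternion.imJ_mul, Quaternion.imK_mul,
    Quaternion.re_neg, Quaternion.imI_neg, Quaternion.imJ_neg, Quaternion.imK_neg,
    Quaternion.re_one, Quaternion.imI_one, Quaternion.imJ_one, Quaternion.imK_one] at h0 h1 h2 h3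
  by_contra hr
  have e1 : I.imI = 0 := by
    have : I.re * I.imI = 0 := by linarith
    simpa [hr] using this
  have e2 : I.imJ = 0 := by
    have : I.re * I.imJ = 0 := by linarith
    simpa [hr] using this
  have e3 : I.imK = 0 := by
    have : I.re * I.imK = 0 := by linarith
    simpa [hr] using this
  rw [e1, e2, e3] at h0
  nlinarith [mul_self_nonneg I.re]

theorem toSlice_eq_smul (I : Quaternion ℝ) (w : ℂ) :
    toSlice I w = w.re • (1 : Quaternion ℝ) + w.im • I := by
  simp [toSlice, Quaternion.coe_mul_eq_smul, ← Quaternion.coe_mul_eq_smul w.re 1]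

theorem toSlice_add (I : Quaternion ℝ) (a b : ℂ) :
    toSlice I (a + b) = toSlice I a + toSlice I b := by
  simp only [toSlice_eq_smul, Complex.add_re, Complex.add_im]
  module

theorem toSlice_neg (I : Quaternion ℝ) (a : ℂ) : toSlice I (-a) = -toSlice I a := by
  simp only [toSlice_eq_smul, Complex.neg_re, Complex.neg_im]
  module

theorem toSlice_mul {I : Quaternion ℝ} (hI : I ∈ QSphere) (a b : ℂ) :
    toSlice I (a * b) = toSlice I a * toSlice I b := by
  simp only [toSlice_eq_smul, Complex.mul_re, Complex.mul_im, mul_add, add_mul, smul_mul_assoc,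
    mul_smul_comm, one_mul, mul_one, QSphere.mul_self hI]
  module

theorem toSlice_ofReal (I : Quaternion ℝ) (x : ℝ) : toSlice I x = x • (1 : Quaternion ℝ) := by
  simp [toSlice_eq_smul]

theorem mul_toSlice_of_anticommute {I J : Quaternion ℝ} (hIJ : I * J = -(J * I)) (a : ℂ) :
    J * toSlice I a = toSlice I (starRingEnd ℂ a) * J := by
  simp only [toSlice_eq_smul, Complex.conj_re, Complex.conj_im, mul_add, add_mul, smul_mul_assoc,
    mul_smul_comm, one_mul, mul_one, hIJ]
  module

theorem neg_mem_QSphere {I : Quaternion ℝ} (hI : I ∈ QSphere) : -I ∈ QSphere := by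
  simpa [QSphere] using hI

theorem toSlice_conj (I : Quaternion ℝ) (w : ℂ) :
    toSlice I (starRingEnd ℂ w) = toSlice (-I) w := by
  simp [toSlice]

theorem continuous_toSlice (I : Quaternion ℝ) : Continuous (toSlice I) := by
  simp only [funext (toSlice_eq_smul I)]
  fun_prop

theorem IsSymmSliceDomain.toSlice_mem {Ω : Set (Quaternion ℝ)} (hΩ : IsSymmSliceDomain Ω)
    {I L : Quaternion ℝ} (hI : I ∈ QSphere) (hL : L ∈ QSphere) {w : ℂ} (hw : toSlice I w ∈ Ω) :
    toSlice L w ∈ Ω :=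
  hΩ.2.2.2.2 w.re w.im I hI hw L hL

theorem IsSymmSliceDomain.toSlice_conj_mem {Ω : Set (Quaternion ℝ)} (hΩ : IsSymmSliceDomain Ω)
    {I : Quaternion ℝ} (hI : I ∈ QSphere) {w : ℂ} (hw : toSlice I w ∈ Ω) :
    toSlice I (starRingEnd ℂ w) ∈ Ω := by
  rw [toSlice_conj]
  exact hΩ.toSlice_mem hI (neg_mem_QSphere hI) hw

theorem IsSymmSliceDomain.isOpen_preimage {Ω : Set (Quaternion ℝ)} (hΩ : IsSymmSliceDomain Ω)
    (I : Quaternion ℝ) : IsOpen {w : ℂ | toSlice I w ∈ Ω} :=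
  hΩ.1.preimage (continuous_toSlice I)

theorem IsSymmSliceDomain.isPreconnected_preimage {Ω : Set (Quaternion ℝ)}
    (hΩ : IsSymmSliceDomain Ω) {I : Quaternion ℝ} (hI : I ∈ QSphere) :
    IsPreconnected {w : ℂ | toSlice I w ∈ Ω} := by
  have hleft : ∀ w : ℂ, (toSlice I w).re + (-(toSlice I w * I).re) * Complex.I = w := by
    intro w
    have h0 := QSphere.re_eq_zero hI
    have h1 := QSphere.mul_self hI
    apply Complex.ext <;> simp [toSlice_eq_smul, h0, add_mul, h1, Quaternion.re_one]
  have himage : {w : ℂ | toSlice I w ∈ Ω} =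
      (fun q : Quaternion ℝ => (q.re : ℂ) + (-(q * I).re) * Complex.I) '' (Ω ∩ sliceL I) := by
    ext w
    constructor
    · intro hw
      exact ⟨toSlice I w, ⟨hw, w.re, w.im, rfl⟩, hleft w⟩
    · rintro ⟨_, ⟨hq, x, y, rfl⟩, rfl⟩
      exact (congrArg (fun w => toSlice I w ∈ Ω) (hleft ⟨x, y⟩)).mpr hq
  rw [himage]
  refine (hΩ.2.2.2.1 I hI).isPreconnected.image _ (Continuous.continuousOn ?_)
  have := Quaternion.continuous_re
  fun_prop

/-- The parametrized restriction of a slice regular function to a slice is real differentiable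
and satisfies the Cauchy-Riemann equation. -/
theorem HoloSlice.hasFDerivAt {f : Quaternion ℝ → Quaternion ℝ} {I : Quaternion ℝ}
    {Ω : Set (Quaternion ℝ)} (hf : HoloSlice f I Ω) {w : ℂ} (hw : toSlice I w ∈ Ω) :
    ∃ f' : ℂ →L[ℝ] Quaternion ℝ, HasFDerivAt (fun z => f (toSlice I z)) f' w ∧
      f' 1 + I * f' Complex.I = 0 := by
  obtain ⟨hd, hcr⟩ := hf w.re w.im hw
  have hd' := (hd.differentiableAt one_ne_zero).hasFDerivAt
  refine ⟨(fderiv ℝ (sliceMap f I) (w.re, w.im)).comp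
    (Complex.equivRealProdCLM : ℂ →L[ℝ] ℝ × ℝ), ?_, ?_⟩
  · exact HasFDerivAt.comp w (f := fun z : ℂ => (z.re, z.im)) hd'
      Complex.equivRealProdCLM.hasFDerivAt
  · simpa using hcr

/-- A function on a plane domain meeting the real axis that is holomorphic for the complex
structure given by left multiplication by `L` vanishes as soon as it vanishes at real points. -/
theorem eq_zero_of_cauchyRiemann_of_real {D : Set ℂ} (hD : IsOpen D) (hDc : IsPreconnected D)
    {x₀ : ℝ} (hx₀ : (x₀ : ℂ) ∈ D) {L : Quaternion ℝ} (hL : L ∈ QSphere) {h : ℂ → Quaternion ℝ}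
    (hh : ∀ w ∈ D, ∃ h' : ℂ →L[ℝ] Quaternion ℝ, HasFDerivAt h h' w ∧
      h' 1 + L * h' Complex.I = 0)
    (hreal : ∀ x : ℝ, (x : ℂ) ∈ D → h x = 0) {w : ℂ} (hw : w ∈ D) : h w = 0 := by
  let φ : Quaternion ℝ →L[ℝ] ℂ :=
    Complex.ofRealCLM.comp (innerSL ℝ (h w)) -
      Complex.I • Complex.ofRealCLM.comp
        ((innerSL ℝ (h w)).comp (ContinuousLinearMap.mul ℝ (Quaternion ℝ) L))
  have hφ : ∀ q, φ q = (inner ℝ (h w) q : ℝ) - Complex.I * (inner ℝ (h w) (L * q) : ℝ) := by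
    intro q
    simp [φ]
  have hφL : ∀ q, φ (L * q) = Complex.I * φ q := by
    intro q
    rw [hφ, hφ, ← mul_assoc, QSphere.mul_self hL]
    simp only [neg_mul, one_mul, inner_neg_right, Complex.ofReal_neg, mul_sub, ← mul_assoc,
      Complex.I_mul_I]
    ring
  have hdiff : DifferentiableOn ℂ (fun z => φ (h z)) D := by
    intro z hz
    obtain ⟨h', hz', hcr⟩ := hh z hz
    refine DifferentiableAt.differentiableWithinAt ?_
    have hcomp : HasFDerivAt (fun z => φ (h z)) (φ.comp h') z := φ.hasFDerivAt.comp z hz'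
    refine differentiableAt_complex_iff_differentiableAt_real.2 ⟨hcomp.differentiableAt, ?_⟩
    rw [hcomp.fderiv]
    have h1 : h' 1 = -(L * h' Complex.I) := eq_neg_of_add_eq_zero_left hcr
    simp only [ContinuousLinearMap.comp_apply, h1, map_neg, hφL, smul_eq_mul]
    rw [mul_neg, ← mul_assoc, Complex.I_mul_I]
    ring
  have hfreq : ∃ᶠ z in nhdsWithin (x₀ : ℂ) {(x₀ : ℂ)}ᶜ, φ (h z) = 0 := by
    have htend : Filter.Tendsto (fun x : ℝ => (x : ℂ)) (nhdsWithin x₀ {x₀}ᶜ)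
        (nhdsWithin (x₀ : ℂ) {(x₀ : ℂ)}ᶜ) := by
      refine Complex.continuous_ofReal.continuousWithinAt.tendsto_nhdsWithin ?_
      intro x hx
      simpa using hx
    refine htend.frequently (Filter.Eventually.frequently ?_)
    have hev : ∀ᶠ x : ℝ in nhds x₀, (x : ℂ) ∈ D :=
      Complex.continuous_ofReal.continuousAt.eventually (hD.mem_nhds hx₀)
    filter_upwards [nhdsWithin_le_nhds hev] with x hx
    rw [hreal x hx, map_zero]
  have hzero := (hdiff.analyticOnNhd hD).eqOn_zero_of_preconnected_of_frequently_eq_zero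
    hDc hx₀ hfreq hw
  have hre := congrArg Complex.re hzero
  simp only [hφ, Complex.sub_re, Complex.ofReal_re, Complex.I_mul_re, Complex.ofReal_im, neg_zero,
    sub_zero, Pi.zero_apply, Complex.zero_re] at hre
  exact inner_self_eq_zero.1 hre

/-- The representation formula for slice regular functions. -/
theorem SliceRegularOn.representation {Ω : Set (Quaternion ℝ)} (hΩ : IsSymmSliceDomain Ω)
    {f : Quaternion ℝ → Quaternion ℝ} (hf : SliceRegularOn f Ω) {I L : Quaternion ℝ}
    (hI : I ∈ QSphere) (hL : L ∈ QSphere) {w : ℂ} (hw : toSlice I w ∈ Ω) :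
    (1 - L * I) * f (toSlice I w) + (1 + L * I) * f (toSlice I (starRingEnd ℂ w)) =
      (2 : ℝ) • f (toSlice L w) := by
  obtain ⟨x₀, hx₀⟩ := hΩ.2.2.1
  rw [← sub_eq_zero]
  refine eq_zero_of_cauchyRiemann_of_real (hΩ.isOpen_preimage I) (hΩ.isPreconnected_preimage hI)
    (x₀ := x₀) (by simpa [toSlice] using hx₀) hL (h := fun z =>
      (1 - L * I) * f (toSlice I z) + (1 + L * I) * f (toSlice I (starRingEnd ℂ z)) -
        (2 : ℝ) • f (toSlice L z)) ?_ ?_ hw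
  · intro z hz
    obtain ⟨a, ha, ha'⟩ := (hf I hI).hasFDerivAt hz
    obtain ⟨b, hb, hb'⟩ := (hf (-I) (neg_mem_QSphere hI)).hasFDerivAt
      (hΩ.toSlice_mem hI (neg_mem_QSphere hI) hz)
    obtain ⟨c, hc, hc'⟩ := (hf L hL).hasFDerivAt (hΩ.toSlice_mem hI hL hz)
    simp only [toSlice_conj]
    refine ⟨_, ((ha.const_mul (1 - L * I)).add (hb.const_mul (1 + L * I))).sub
      (hc.const_smul (2 : ℝ)), ?_⟩
    have hII := QSphere.mul_self hI
    have hLL := QSphere.mul_self hL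
    have ea : a 1 = -(I * a Complex.I) := eq_neg_of_add_eq_zero_left ha'
    have eb : b 1 = I * b Complex.I := by
      rw [neg_mul, ← sub_eq_add_neg] at hb'
      exact sub_eq_zero.1 hb'
    have ec : c 1 = -(L * c Complex.I) := eq_neg_of_add_eq_zero_left hc'
    have hI' : ∀ q, I * (I * q) = -q := fun q => by rw [← mul_assoc, hII, neg_one_mul]
    have hL' : ∀ q, L * (L * q) = -q := fun q => by rw [← mul_assoc, hLL, neg_one_mul]
    simp only [add_apply, sub_apply,
      smul_apply, smul_eq_mul, ea, eb, ec, sub_mul, add_mul, mul_add, mul_sub,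
      one_mul, mul_assoc, mul_neg, hI', hL', mul_smul_comm, smul_neg]
    abel
  · intro x _
    simp only [Complex.conj_ofReal, toSlice_ofReal]
    rw [← add_mul, two_smul]
    noncomm_ring

/-- For `c = dJ` orthogonal to `I`, the equation `(1 - LI)c + (1 + LI) = 0` is solved by an
imaginary unit `L`. -/
theorem exists_QSphere_mul_add_eq_zero {I J : Quaternion ℝ} (hI : I ∈ QSphere) (hJ : J ∈ QSphere)
    (hIJ : I * J = -(J * I)) (d : ℂ) :
    ∃ L ∈ QSphere, (1 - L * I) * (toSlice I d * J) + (1 + L * I) = 0 := by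
  have hII := QSphere.mul_self hI
  have hJJ := QSphere.mul_self hJ
  obtain ⟨c, hc⟩ : ∃ c, c = toSlice I d * J := ⟨_, rfl⟩
  obtain ⟨s, hs⟩ : ∃ s, s = Complex.normSq d := ⟨_, rfl⟩
  have hs1 : 1 + s ≠ 0 := by
    have := Complex.normSq_nonneg d
    rw [hs]
    positivity
  have hcc : c * c = -(s • (1 : Quaternion ℝ)) := by
    calc c * c = toSlice I d * (J * toSlice I d) * J := by rw [hc]; noncomm_ring
      _ = toSlice I (d * starRingEnd ℂ d) * (J * J) := by
        rw [mul_toSlice_of_anticommute hIJ, toSlice_mul hI]; noncomm_ring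
      _ = -(s • (1 : Quaternion ℝ)) := by
        rw [Complex.mul_conj, toSlice_ofReal, hJJ, hs, mul_neg_one]
  have hIc : I * c = -(c * I) := by
    have hcomm : I * toSlice I d = toSlice I d * I := by
      simp [toSlice_eq_smul, mul_add, add_mul]
    rw [hc, ← mul_assoc, hcomm, mul_assoc, hIJ, mul_neg, ← mul_assoc]
  have hcIc : c * I * c = s • I := by
    rw [mul_assoc, hIc, mul_neg, ← mul_assoc, hcc]
    simp
  rw [← hc]
  refine ⟨(1 + s)⁻¹ • ((1 - s) • I + (2 : ℝ) • (c * I)), ?_, ?_⟩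
  · have hcIcI : c * I * (c * I) = -(s • (1 : Quaternion ℝ)) := by
      rw [← mul_assoc, hcIc, smul_mul_assoc, hII, smul_neg]
    have hIcI : I * (c * I) = c := by
      rw [← mul_assoc, hIc, neg_mul, mul_assoc, hII, mul_neg_one, neg_neg]
    have hcII : c * I * I = -c := by rw [mul_assoc, hII, mul_neg_one]
    change _ ^ 2 = _
    rw [sq]
    simp only [smul_mul_assoc, mul_smul_comm, mul_add, add_mul, hII, hcIcI, hIcI, hcII]
    match_scalars <;> field_simp <;> ring
  · have hcII : c * I * I = -c := by rw [mul_assoc, hII, mul_neg_one]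
    simp only [smul_mul_assoc, add_mul, sub_mul, one_mul, hII, hcII, neg_mul, hcc, smul_add,
      smul_neg]
    match_scalars <;> field_simp <;> ring

/-- If `α f_ℓ(z) = β J f_ℓ(z̄)` for all `ℓ` with `(α, β) ≠ 0`, the slice regular functions `f_ℓ`
have a common zero on the sphere through `z`. -/
theorem exists_common_zero_of_proportional {Ω : Set (Quaternion ℝ)} (hΩ : IsSymmSliceDomain Ω)
    {ι : Type*} {f : ι → Quaternion ℝ → Quaternion ℝ} (hreg : ∀ ℓ, SliceRegularOn (f ℓ) Ω)
    {I J : Quaternion ℝ} (hI : I ∈ QSphere) (hJ : J ∈ QSphere) (hIJ : I * J = -(J * I))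
    {w : ℂ} (hw : toSlice I w ∈ Ω) {α β : ℂ} (hαβ : ¬(α = 0 ∧ β = 0))
    (hprop : ∀ ℓ, toSlice I α * f ℓ (toSlice I w) =
      toSlice I β * (J * f ℓ (toSlice I (starRingEnd ℂ w)))) :
    ∃ q ∈ Ω, ∀ ℓ, f ℓ q = 0 := by
  have hone : toSlice I 1 = 1 := by simpa using toSlice_ofReal I 1
  have hzero : toSlice I 0 = 0 := by simpa using toSlice_ofReal I 0
  have hinv : ∀ a : ℂ, a ≠ 0 → toSlice I a⁻¹ * toSlice I a = 1 := fun a ha => by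
    rw [← toSlice_mul hI, inv_mul_cancel₀ ha, hone]
  by_cases hα : α = 0
  · have hβ : β ≠ 0 := fun h => hαβ ⟨hα, h⟩
    refine ⟨_, hΩ.toSlice_conj_mem hI hw, fun ℓ => ?_⟩
    have h1 := hprop ℓ
    rw [hα, hzero, zero_mul] at h1
    have hβ0 : toSlice I β ≠ 0 := fun h => by simpa [h] using hinv β hβ
    have hJ0 : J ≠ 0 := fun h => by simpa [h] using QSphere.mul_self hJ
    simpa [hβ0, hJ0] using h1.symm
  · obtain ⟨L, hL, hLc⟩ := exists_QSphere_mul_add_eq_zero hI hJ hIJ (α⁻¹ * β)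
    refine ⟨_, hΩ.toSlice_mem hI hL hw, fun ℓ => ?_⟩
    have hfz : f ℓ (toSlice I w) =
        toSlice I (α⁻¹ * β) * J * f ℓ (toSlice I (starRingEnd ℂ w)) := by
      rw [toSlice_mul hI, mul_assoc, mul_assoc, ← hprop ℓ, ← mul_assoc, hinv α hα, one_mul]
    have hrep := (hreg ℓ).representation hΩ hI hL hw
    rw [hfz, ← mul_assoc, ← add_mul, hLc, zero_mul] at hrep
    simpa using hrep.symm

theorem exists_dual_pair {𝕜 ι : Type*} [Field 𝕜] [Fintype ι] (a b : ι → 𝕜)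
    (hab : ∀ α β : 𝕜, (∀ i, α * a i + β * b i = 0) → α = 0 ∧ β = 0) :
    ∃ x y : ι → 𝕜, ∑ i, a i * x i = 1 ∧ ∑ i, b i * x i = 0 ∧
      ∑ i, a i * y i = 0 ∧ ∑ i, b i * y i = 1 := by
  classical
  obtain ⟨i, j, hij⟩ : ∃ i j, a i * b j - a j * b i ≠ 0 := by
    by_contra! hdet
    obtain ⟨i, hi⟩ : ∃ i, a i ≠ 0 := by
      by_contra! ha
      exact one_ne_zero (hab 1 0 fun i => by simp [ha i]).1
    refine hi (neg_eq_zero.1 (hab (b i) (-a i) fun j => ?_).2)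
    linear_combination -hdet i j
  set Δ := a i * b j - a j * b i with hΔ
  have hsum : ∀ (c : ι → 𝕜) (p q : 𝕜),
      ∑ k, c k * (Pi.single i p - Pi.single j q : ι → 𝕜) k = c i * p - c j * q := fun c p q => by
    simp [mul_sub, Finset.sum_sub_distrib, Pi.single_apply]
  refine ⟨Pi.single i (b j * Δ⁻¹) - Pi.single j (b i * Δ⁻¹),
    Pi.single i (-a j * Δ⁻¹) - Pi.single j (-a i * Δ⁻¹), ?_, ?_, ?_, ?_⟩ <;> rw [hsum]
  · linear_combination mul_inv_cancel₀ hij - Δ⁻¹ * hΔ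
  · ring
  · ring
  · linear_combination mul_inv_cancel₀ hij - Δ⁻¹ * hΔ

/-- Vectors satisfying a pointwise condition at two points are interpolated by a holomorphic
vector-valued function satisfying the condition at both points. -/
theorem exists_differentiable_interpolation {ι : Type*} (P : ℂ → (ι → ℂ) → Prop) {z₁ z₂ : ℂ}
    (h₁ : ∃ x, P z₁ x) (h₂ : ∃ x, P z₂ x) :
    ∃ x : ι → ℂ → ℂ, (∀ i, Differentiable ℂ (x i)) ∧ P z₁ (fun i => x i z₁) ∧
      P z₂ (fun i => x i z₂) := by
  obtain ⟨x₁, hx₁⟩ := h₁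
  by_cases h : z₁ = z₂
  · subst h
    exact ⟨fun i _ => x₁ i, fun i => differentiable_const _, hx₁, hx₁⟩
  · obtain ⟨x₂, hx₂⟩ := h₂
    refine ⟨fun i z => x₁ i + (z - z₁) * ((x₂ i - x₁ i) / (z₂ - z₁)), fun i => by fun_prop, ?_, ?_⟩
    · simpa using hx₁
    · have h' : z₂ - z₁ ≠ 0 := sub_ne_zero.2 (Ne.symm h)
      have heq : (fun i => x₁ i + (z₂ - z₁) * ((x₂ i - x₁ i) / (z₂ - z₁))) = x₂ := by
        funext i
        field_simp
        ring
      simpa only [heq] using hx₂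

/-- A holomorphic linear system of two equations that has rank two at two points has a holomorphic
solution on a common neighbourhood of these points. -/
theorem exists_holomorphic_solution {ι : Type*} [Fintype ι] {D : Set ℂ} (hD : IsOpen D)
    {a b : ι → ℂ → ℂ} (ha : ∀ i, DifferentiableOn ℂ (a i) D)
    (hb : ∀ i, DifferentiableOn ℂ (b i) D)
    (hab : ∀ z ∈ D, ∀ α β : ℂ, (∀ i, α * a i z + β * b i z = 0) → α = 0 ∧ β = 0)
    {z₁ z₂ : ℂ} (h₁ : z₁ ∈ D) (h₂ : z₂ ∈ D) :
    ∃ U ⊆ D, IsOpen U ∧ z₁ ∈ U ∧ z₂ ∈ U ∧ ∃ X : ι → ℂ → ℂ,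
      (∀ i, DifferentiableOn ℂ (X i) U) ∧
      ∀ z ∈ U, ∑ i, a i z * X i z = 1 ∧ ∑ i, b i z * X i z = 0 := by
  have hdual : ∀ z ∈ D, ∃ v : ι ⊕ ι → ℂ,
      ∑ i, a i z * v (.inl i) = 1 ∧ ∑ i, b i z * v (.inl i) = 0 ∧
      ∑ i, a i z * v (.inr i) = 0 ∧ ∑ i, b i z * v (.inr i) = 1 := by
    intro z hz
    obtain ⟨x, y, h⟩ := exists_dual_pair (fun i => a i z) (fun i => b i z) (hab z hz)
    exact ⟨Sum.elim x y, by simpa using h⟩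
  obtain ⟨v, hv, hv₁, hv₂⟩ := exists_differentiable_interpolation
    (fun z (v : ι ⊕ ι → ℂ) => ∑ i, a i z * v (.inl i) = 1 ∧ ∑ i, b i z * v (.inl i) = 0 ∧
      ∑ i, a i z * v (.inr i) = 0 ∧ ∑ i, b i z * v (.inr i) = 1) (hdual z₁ h₁) (hdual z₂ h₂)
  have hsum : ∀ (c : ι → ℂ → ℂ) (e : ι → ι ⊕ ι), (∀ i, DifferentiableOn ℂ (c i) D) →
      DifferentiableOn ℂ (fun z => ∑ i, c i z * v (e i) z) D := fun c e hc =>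
    DifferentiableOn.fun_sum fun i _ => (hc i).mul (hv (e i)).differentiableOn
  have hax := hsum a .inl ha
  have hbx := hsum b .inl hb
  have hay := hsum a .inr ha
  have hby := hsum b .inr hb
  set aX : ℂ → ℂ := fun z => ∑ i, a i z * v (.inl i) z with hax_def
  set bX : ℂ → ℂ := fun z => ∑ i, b i z * v (.inl i) z with hbx_def
  set aY : ℂ → ℂ := fun z => ∑ i, a i z * v (.inr i) z with hay_def
  set bY : ℂ → ℂ := fun z => ∑ i, b i z * v (.inr i) z with hby_def
  have hΔ : DifferentiableOn ℂ (fun z => aX z * bY z - aY z * bX z) D :=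
    (hax.mul hby).sub (hay.mul hbx)
  refine ⟨D ∩ (fun z => aX z * bY z - aY z * bX z) ⁻¹' {0}ᶜ, Set.inter_subset_left,
    hΔ.continuousOn.isOpen_inter_preimage hD isOpen_compl_singleton, ⟨h₁, ?_⟩, ⟨h₂, ?_⟩,
    fun i z => (v (.inl i) z * bY z - v (.inr i) z * bX z) / (aX z * bY z - aY z * bX z), ?_, ?_⟩
  · simp [hax_def, hbx_def, hay_def, hby_def, hv₁]
  · simp [hax_def, hbx_def, hay_def, hby_def, hv₂]
  · intro i
    refine DifferentiableOn.div ?_ (hΔ.mono Set.inter_subset_left) fun z hz => hz.2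
    exact (((hv _).differentiableOn.mul hby).sub
      ((hv _).differentiableOn.mul hbx)).mono Set.inter_subset_left
  · rintro z ⟨-, hz⟩
    have hz' : aX z * bY z - aY z * bX z ≠ 0 := hz
    have hcomb : ∀ (c : ι → ℂ → ℂ) (p q r : ℂ),
        ∑ i, c i z * ((v (.inl i) z * p - v (.inr i) z * q) / r) =
        ((∑ i, c i z * v (.inl i) z) * p - (∑ i, c i z * v (.inr i) z) * q) / r := by
      intro c p q r
      rw [Finset.sum_mul, Finset.sum_mul, ← Finset.sum_sub_distrib, Finset.sum_div]
      exact Finset.sum_congr rfl fun i _ => by ring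
    refine ⟨(hcomb a _ _ _).trans (div_self hz'), (hcomb b _ _ _).trans ?_⟩
    change (bX z * bY z - bY z * bX z) / _ = 0
    rw [mul_comm, sub_self, zero_div]

theorem hatC_hatC (H : ℂ → ℂ) : hatC (hatC H) = H := by
  funext w
  simp [hatC]

theorem differentiableOn_hatC {H : ℂ → ℂ} {U : Set ℂ} (hU : IsOpen U)
    (hconj : ∀ w ∈ U, starRingEnd ℂ w ∈ U) (hH : DifferentiableOn ℂ H U) :
    DifferentiableOn ℂ (hatC H) U := by
  intro w hw
  have h := (hH.differentiableAt (hU.mem_nhds (hconj w hw))).hasDerivAt.conj_conj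
  rw [Complex.conj_conj] at h
  exact h.differentiableAt.differentiableWithinAt

/-- If `α F_ℓ + β Ĝ_ℓ = 0` and `-α G_ℓ + β F̂_ℓ = 0` at `w`, then
`α f_ℓ(w) = β J f_ℓ(w̄)` for the functions `f_ℓ = F_ℓ + G_ℓ J`. -/
theorem toSlice_mul_split_eq {I J : Quaternion ℝ} (hI : I ∈ QSphere) (hJ : J ∈ QSphere)
    (hIJ : I * J = -(J * I)) {F G : ℂ → ℂ} {w α β : ℂ}
    (h₁ : α * F w + β * hatC G w = 0) (h₂ : α * -G w + β * hatC F w = 0) :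
    toSlice I α * (toSlice I (F w) + toSlice I (G w) * J) =
      toSlice I β * (J * (toSlice I (F (starRingEnd ℂ w)) +
        toSlice I (G (starRingEnd ℂ w)) * J)) := by
  have e₁ : α * F w = -(β * hatC G w) := eq_neg_of_add_eq_zero_left h₁
  have e₂ : α * G w = β * hatC F w := by linear_combination -h₂
  have hJJ := QSphere.mul_self hJ
  rw [mul_add, ← mul_assoc, ← toSlice_mul hI, ← toSlice_mul hI, e₁, e₂, mul_add, ← mul_assoc J,
    mul_toSlice_of_anticommute hIJ, mul_toSlice_of_anticommute hIJ, mul_assoc _ J J, hJJ,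
    toSlice_neg, toSlice_mul hI, toSlice_mul hI]
  simp only [hatC]
  noncomm_ring

/-- Local solvability on a slice, general `n`: if `f₁, …, fₙ` are slice regular on a
symmetric slice domain `Ω` without common zeros and `f_ℓ = F_ℓ + G_ℓ J` is a splitting
on `Ω_I` (identified with a subset of `ℂ` via `toSlice I`), then near any point of
`Ω_I` there is a conjugation-invariant open set `U` and holomorphic `H_ℓ, K_ℓ` on `U`
with `Σ (F_ℓ H_ℓ − G_ℓ K̂_ℓ) = 1` and `Σ (F_ℓ K_ℓ + G_ℓ Ĥ_ℓ) = 0` on `U`. -/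
theorem local_splitting_solution_on_slice
    (Ω : Set (Quaternion ℝ)) (hΩ : IsSymmSliceDomain Ω)
    (n : ℕ) (f : Fin n → Quaternion ℝ → Quaternion ℝ)
    (hreg : ∀ ℓ, SliceRegularOn (f ℓ) Ω)
    (hnz : ∀ q ∈ Ω, ∃ ℓ, f ℓ q ≠ 0)
    (I J : Quaternion ℝ) (hI : I ∈ QSphere) (hJ : J ∈ QSphere)
    (hIJ : I * J = -(J * I))
    (F G : Fin n → ℂ → ℂ)
    (hF : ∀ ℓ, DifferentiableOn ℂ (F ℓ) {w : ℂ | toSlice I w ∈ Ω})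
    (hG : ∀ ℓ, DifferentiableOn ℂ (G ℓ) {w : ℂ | toSlice I w ∈ Ω})
    (hsplit : ∀ ℓ, ∀ w : ℂ, toSlice I w ∈ Ω →
      f ℓ (toSlice I w) = toSlice I (F ℓ w) + toSlice I (G ℓ w) * J) :
    ∀ w₀ : ℂ, toSlice I w₀ ∈ Ω →
      ∃ U : Set ℂ, IsOpen U ∧ w₀ ∈ U ∧ U ⊆ {w : ℂ | toSlice I w ∈ Ω} ∧
        (∀ w ∈ U, starRingEnd ℂ w ∈ U) ∧
        ∃ H K : Fin n → ℂ → ℂ,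
          (∀ ℓ, DifferentiableOn ℂ (H ℓ) U ∧ DifferentiableOn ℂ (K ℓ) U) ∧
          ∀ w ∈ U,
            (∑ ℓ, (F ℓ w * H ℓ w - G ℓ w * hatC (K ℓ) w)) = 1 ∧
            (∑ ℓ, (F ℓ w * K ℓ w + G ℓ w * hatC (H ℓ) w)) = 0 := by
  intro w₀ hw₀
  have hDopen := hΩ.isOpen_preimage I
  have hDconj : ∀ w ∈ {w : ℂ | toSlice I w ∈ Ω}, starRingEnd ℂ w ∈ {w : ℂ | toSlice I w ∈ Ω} :=
    fun w hw => hΩ.toSlice_conj_mem hI hw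
  have hrank : ∀ w ∈ {w : ℂ | toSlice I w ∈ Ω}, ∀ α β : ℂ,
      (∀ i : Fin n ⊕ Fin n, α * Sum.elim F (fun ℓ z => -G ℓ z) i w +
        β * Sum.elim (fun ℓ => hatC (G ℓ)) (fun ℓ => hatC (F ℓ)) i w = 0) →
      α = 0 ∧ β = 0 := by
    intro w hw α β h
    by_contra hαβ
    obtain ⟨q, hq, hq0⟩ := exists_common_zero_of_proportional hΩ hreg hI hJ hIJ hw hαβ fun ℓ => by
      rw [hsplit ℓ w hw, hsplit ℓ _ (hDconj w hw)]
      exact toSlice_mul_split_eq hI hJ hIJ (h (.inl ℓ)) (h (.inr ℓ))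
    obtain ⟨ℓ, hℓ⟩ := hnz q hq
    exact hℓ (hq0 ℓ)
  obtain ⟨U, hUD, hU, h₁, h₂, X, hX, hsol⟩ := exists_holomorphic_solution hDopen
    (Sum.rec hF fun ℓ => (hG ℓ).neg)
    (Sum.rec (fun ℓ => differentiableOn_hatC hDopen hDconj (hG ℓ))
      fun ℓ => differentiableOn_hatC hDopen hDconj (hF ℓ))
    hrank hw₀ (hDconj w₀ hw₀)
  have hV : IsOpen (U ∩ starRingEnd ℂ ⁻¹' U) := hU.inter (hU.preimage Complex.continuous_conj)
  have hVconj : ∀ w ∈ U ∩ starRingEnd ℂ ⁻¹' U, starRingEnd ℂ w ∈ U ∩ starRingEnd ℂ ⁻¹' U :=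
    fun w hw => ⟨hw.2, by simpa using hw.1⟩
  refine ⟨U ∩ starRingEnd ℂ ⁻¹' U, hV, ⟨h₁, h₂⟩, fun w hw => hUD hw.1, hVconj,
    fun ℓ => X (.inl ℓ), fun ℓ => hatC (X (.inr ℓ)), fun ℓ => ⟨(hX _).mono Set.inter_subset_left,
      differentiableOn_hatC hV hVconj ((hX _).mono Set.inter_subset_left)⟩, fun w hw => ⟨?_, ?_⟩⟩
  · have h := (hsol w hw.1).1
    rw [Fintype.sum_sum_type, ← Finset.sum_add_distrib] at h
    rw [← h]
    refine Finset.sum_congr rfl fun ℓ _ => ?_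
    simp only [hatC_hatC, Sum.elim_inl, Sum.elim_inr]
    ring
  · have h := congrArg (starRingEnd ℂ) (hsol _ hw.2).2
    rw [Fintype.sum_sum_type, ← Finset.sum_add_distrib, map_sum, map_zero] at h
    rw [← h]
    refine Finset.sum_congr rfl fun ℓ _ => ?_
    simp only [hatC, Sum.elim_inl, Sum.elim_inr, map_add, map_mul, Complex.conj_conj]
    ring
end
end

section
/- Let f(q) = Σ_{n≥0} qⁿaₙ and g(q) = Σ_{n≥0} qⁿbₙ be quaternionic power series, both converging on the ball B(0,R), R > 0. Then: (i) for every n, conj(Σ_{m=0}^{n} aₘ b_{n−m}) = Σ_{m=0}^{n} conj(bₘ) · conj(a_{n−m}); equivalently, the regular conjugate of the Cauchy product of f and g equals the Cauchy product of g^c and f^c, i.e. (f*g)^c = g^c * f^c; (ii) for every q ∈ B(0,R), the symmetrization of the Cauchy product satisfies (f*g)^s(q) = f^s(q) · g^s(q) = g^s(q) · f^s(q). -/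
noncomputable section

/-- The coefficients of the Cauchy product of two quaternionic power series:
`cₙ = Σ_{m=0}^{n} aₘ b_{n−m}`. -/
def cauchyCoeff (a b : ℕ → Quaternion ℝ) (n : ℕ) : Quaternion ℝ :=
  ∑ m ∈ Finset.range (n + 1), a m * b (n - m)

/-- The coefficients of the regular conjugate `f^c(q) = Σ qⁿ conj(aₙ)`. -/
def regConjCoeff (a : ℕ → Quaternion ℝ) : ℕ → Quaternion ℝ := fun n => star (a n)

/-- The coefficients of the symmetrization `f^s = f * f^c`. -/
def symCoeff (a : ℕ → Quaternion ℝ) : ℕ → Quaternion ℝ :=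
  cauchyCoeff a (regConjCoeff a)

open PowerSeries in
theorem mk_cauchyCoeff (a b : ℕ → Quaternion ℝ) : mk (cauchyCoeff a b) = mk a * mk b := by
  ext1 n
  rw [coeff_mk, coeff_mul, Finset.Nat.sum_antidiagonal_eq_sum_range_succ_mk]
  simp [cauchyCoeff]

theorem cauchyCoeff_eq_sum_antidiagonal (a b : ℕ → Quaternion ℝ) (n : ℕ) :
    cauchyCoeff a b n = ∑ p ∈ Finset.HasAntidiagonal.antidiagonal n, a p.1 * b p.2 := by
  rw [Finset.Nat.sum_antidiagonal_eq_sum_range_succ_mk, cauchyCoeff]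

theorem cauchyCoeff_assoc (a b c : ℕ → Quaternion ℝ) :
    cauchyCoeff (cauchyCoeff a b) c = cauchyCoeff a (cauchyCoeff b c) := by
  have h : PowerSeries.mk (cauchyCoeff (cauchyCoeff a b) c) =
      PowerSeries.mk (cauchyCoeff a (cauchyCoeff b c)) := by
    simp only [mk_cauchyCoeff, mul_assoc]
  funext n
  simpa using congrArg (PowerSeries.coeff n) h

theorem cauchyCoeff_comm_of_commute {a b : ℕ → Quaternion ℝ} (h : ∀ m n, Commute (a m) (b n)) :
    cauchyCoeff a b = cauchyCoeff b a := by
  funext n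
  rw [cauchyCoeff_eq_sum_antidiagonal, cauchyCoeff_eq_sum_antidiagonal,
    ← Finset.Nat.sum_antidiagonal_swap]
  exact Finset.sum_congr rfl fun p _ => h p.2 p.1

theorem regConjCoeff_cauchyCoeff (a b : ℕ → Quaternion ℝ) :
    regConjCoeff (cauchyCoeff a b) = cauchyCoeff (regConjCoeff b) (regConjCoeff a) := by
  funext n
  rw [regConjCoeff, cauchyCoeff_eq_sum_antidiagonal, cauchyCoeff_eq_sum_antidiagonal, star_sum,
    ← Finset.Nat.sum_antidiagonal_swap]
  simp [regConjCoeff]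

theorem regConjCoeff_regConjCoeff (a : ℕ → Quaternion ℝ) :
    regConjCoeff (regConjCoeff a) = a := by
  funext n
  simp [regConjCoeff]

theorem star_symCoeff (a : ℕ → Quaternion ℝ) (n : ℕ) : star (symCoeff a n) = symCoeff a n := by
  have h : regConjCoeff (symCoeff a) = symCoeff a := by
    rw [symCoeff, regConjCoeff_cauchyCoeff, regConjCoeff_regConjCoeff]
  exact congrFun h n

/-- The coefficients of a symmetrization are real, hence central. -/
theorem symCoeff_commute (a : ℕ → Quaternion ℝ) (n : ℕ) (q : Quaternion ℝ) :
    Commute (symCoeff a n) q := by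
  rw [Quaternion.star_eq_self.mp (star_symCoeff a n)]
  exact Quaternion.coe_commute _ q

theorem symCoeff_cauchyCoeff (a b : ℕ → Quaternion ℝ) :
    symCoeff (cauchyCoeff a b) = cauchyCoeff (symCoeff a) (symCoeff b) := by
  calc symCoeff (cauchyCoeff a b)
      = cauchyCoeff a (cauchyCoeff (symCoeff b) (regConjCoeff a)) := by
        rw [symCoeff, regConjCoeff_cauchyCoeff, cauchyCoeff_assoc, ← cauchyCoeff_assoc b,
          ← symCoeff]
    _ = cauchyCoeff a (cauchyCoeff (regConjCoeff a) (symCoeff b)) := by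
        rw [cauchyCoeff_comm_of_commute fun m n => symCoeff_commute b m _]
    _ = cauchyCoeff (symCoeff a) (symCoeff b) := by
        rw [← cauchyCoeff_assoc, ← symCoeff]

theorem summable_norm_pow_mul_cauchyCoeff {a b : ℕ → Quaternion ℝ} {q : Quaternion ℝ}
    (ha : Summable fun n => ‖q ^ n * a n‖) (hb : Summable fun n => ‖q ^ n * b n‖) :
    Summable fun n => ‖q ^ n * cauchyCoeff a b n‖ := by
  refine Summable.of_nonneg_of_le (fun _ => norm_nonneg _) (fun n => ?_)
    (summable_sum_mul_antidiagonal_of_summable_mul (f := fun n => ‖q ^ n * a n‖)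
      (g := fun n => ‖q ^ n * b n‖)
      (ha.mul_of_nonneg hb (fun _ => norm_nonneg _) fun _ => norm_nonneg _))
  rw [cauchyCoeff_eq_sum_antidiagonal, Finset.mul_sum]
  refine (norm_sum_le _ _).trans (Finset.sum_le_sum fun p hp => le_of_eq ?_)
  rw [← Finset.HasAntidiagonal.mem_antidiagonal.mp hp]
  simp only [norm_mul, norm_pow, pow_add]
  ring

theorem summable_norm_pow_mul_symCoeff {a : ℕ → Quaternion ℝ} {q : Quaternion ℝ}
    (ha : Summable fun n => q ^ n * a n) : Summable fun n => ‖q ^ n * symCoeff a n‖ := by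
  refine summable_norm_pow_mul_cauchyCoeff ha.norm ?_
  simpa [regConjCoeff] using ha.norm

/-- If the coefficients of the left factor commute with `q`, evaluation at `q` takes the Cauchy
product to the pointwise product. -/
theorem tsum_pow_mul_cauchyCoeff {a b : ℕ → Quaternion ℝ} {q : Quaternion ℝ}
    (ha : Summable fun n => ‖q ^ n * a n‖) (hb : Summable fun n => ‖q ^ n * b n‖)
    (hq : ∀ n, Commute (a n) q) :
    ∑' n, q ^ n * cauchyCoeff a b n = (∑' n, q ^ n * a n) * ∑' n, q ^ n * b n := by
  rw [tsum_mul_tsum_eq_tsum_sum_antidiagonal_of_summable_norm ha hb]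
  refine tsum_congr fun n => ?_
  rw [cauchyCoeff_eq_sum_antidiagonal, Finset.mul_sum]
  refine Finset.sum_congr rfl fun p hp => ?_
  rw [← Finset.HasAntidiagonal.mem_antidiagonal.mp hp, pow_add, mul_assoc, mul_assoc, ← mul_assoc (a p.1),
    ((hq p.1).pow_right p.2).eq, mul_assoc]

/-- For quaternionic power series `f(q) = Σ qⁿaₙ` and `g(q) = Σ qⁿbₙ` converging on
`B(0,R)`: (i) `(f*g)^c = g^c * f^c` at the level of coefficients; (ii) the
symmetrization of the Cauchy product satisfies
`(f*g)^s(q) = f^s(q) · g^s(q) = g^s(q) · f^s(q)` on `B(0,R)`. -/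
theorem conjugate_and_symmetrization_of_cauchy_product
    (R : ℝ) (hR : 0 < R) (a b : ℕ → Quaternion ℝ)
    (hf : ∀ q : Quaternion ℝ, ‖q‖ < R → Summable (fun n => q ^ n * a n))
    (hg : ∀ q : Quaternion ℝ, ‖q‖ < R → Summable (fun n => q ^ n * b n)) :
    (∀ n, star (cauchyCoeff a b n) = cauchyCoeff (regConjCoeff b) (regConjCoeff a) n) ∧
    ∀ q : Quaternion ℝ, ‖q‖ < R →
      (∑' n, q ^ n * symCoeff (cauchyCoeff a b) n) =
        (∑' n, q ^ n * symCoeff a n) * (∑' n, q ^ n * symCoeff b n) ∧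
      (∑' n, q ^ n * symCoeff a n) * (∑' n, q ^ n * symCoeff b n) =
        (∑' n, q ^ n * symCoeff b n) * (∑' n, q ^ n * symCoeff a n) := by
  refine ⟨fun n => congrFun (regConjCoeff_cauchyCoeff a b) n, fun q hq => ?_⟩
  have ha := summable_norm_pow_mul_symCoeff (hf q hq)
  have hb := summable_norm_pow_mul_symCoeff (hg q hq)
  rw [symCoeff_cauchyCoeff, ← tsum_pow_mul_cauchyCoeff ha hb fun n => symCoeff_commute a n q,
    ← tsum_pow_mul_cauchyCoeff hb ha fun n => symCoeff_commute b n q,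
    cauchyCoeff_comm_of_commute fun m n => symCoeff_commute a m (symCoeff b n)]
  exact ⟨rfl, rfl⟩
end
end

section
/- (Identity Principle) Let Ω ⊆ ℍ be a symmetric slice domain and let f : Ω → ℍ be a slice regular function. Denote by Z_f = {q ∈ Ω : f(q) = 0} its zero set. If there exists I ∈ 𝕊 such that Z_f ∩ Ω_I has an accumulation point in Ω_I, then f vanishes identically on Ω. -/
noncomputable section

open Filter Topology

/-- An imaginary unit has zero real part and unit imaginary part. -/
theorem re_eq_zero_and_normSq_im_of_mem_QSphere {I : Quaternion ℝ} (hI : I ∈ QSphere) :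
    I.re = 0 ∧ I.imI ^ 2 + I.imJ ^ 2 + I.imK ^ 2 = 1 := by
  have h : I * I = -1 := by rw [← sq]; exact hI
  obtain ⟨hr, hi, hj, hk⟩ := Quaternion.ext_iff.mp h
  simp only [Quaternion.re_mul, Quaternion.imI_mul, Quaternion.imJ_mul, Quaternion.imK_mul,
    Quaternion.re_neg, Quaternion.imI_neg, Quaternion.imJ_neg, Quaternion.imK_neg,
    Quaternion.re_one, Quaternion.imI_one, Quaternion.imJ_one, Quaternion.imK_one] at hr hi hj hk
  have h0 : I.re = 0 := by
    by_contra hne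
    have hi' : I.imI = 0 := mul_left_cancel₀ hne (by linarith)
    have hj' : I.imJ = 0 := mul_left_cancel₀ hne (by linarith)
    have hk' : I.imK = 0 := mul_left_cancel₀ hne (by linarith)
    rw [hi', hj', hk'] at hr
    nlinarith [sq_nonneg I.re]
  rw [h0] at hr
  exact ⟨h0, by linarith⟩

/-- The embedding `x + iy ↦ x + yI` of `ℂ` onto the slice `L_I`. -/
def sliceEmb (I : Quaternion ℝ) (hI : I ∈ QSphere) : ℂ →ₐ[ℝ] Quaternion ℝ :=
  Complex.lift ⟨I, by rw [← sq]; exact hI⟩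

theorem sliceEmb_apply {I : Quaternion ℝ} (hI : I ∈ QSphere) (z : ℂ) :
    sliceEmb I hI z = (z.re : Quaternion ℝ) + (z.im : Quaternion ℝ) * I := by
  simp [sliceEmb, Complex.liftAux_apply, Quaternion.coe_mul_eq_smul]

theorem norm_sliceEmb {I : Quaternion ℝ} (hI : I ∈ QSphere) (z : ℂ) :
    ‖sliceEmb I hI z‖ = ‖z‖ := by
  obtain ⟨h0, h1⟩ := re_eq_zero_and_normSq_im_of_mem_QSphere hI
  rw [← sq_eq_sq₀ (norm_nonneg _) (norm_nonneg _), Complex.sq_norm, Complex.normSq_apply, sq,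
    ← Quaternion.normSq_eq_norm_mul_self, Quaternion.normSq_def', sliceEmb_apply]
  simp [h0]
  linear_combination z.im ^ 2 * h1

theorem isometry_sliceEmb {I : Quaternion ℝ} (hI : I ∈ QSphere) : Isometry (sliceEmb I hI) :=
  AddMonoidHomClass.isometry_of_norm _ (norm_sliceEmb hI)

theorem range_sliceEmb {I : Quaternion ℝ} (hI : I ∈ QSphere) :
    Set.range (sliceEmb I hI) = sliceL I := by
  ext q
  constructor
  · rintro ⟨z, rfl⟩
    exact ⟨z.re, z.im, sliceEmb_apply hI z⟩
  · rintro ⟨x, y, rfl⟩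
    exact ⟨⟨x, y⟩, sliceEmb_apply hI _⟩

/-- The complex normed space structure on the quaternions given by left multiplication by the
elements of the slice `L_I`. -/
abbrev sliceNormedSpace (I : Quaternion ℝ) (hI : I ∈ QSphere) : NormedSpace ℂ (Quaternion ℝ) where
  toModule := Module.compHom (Quaternion ℝ) (sliceEmb I hI).toRingHom
  norm_smul_le z q := by
    change ‖sliceEmb I hI z * q‖ ≤ _
    rw [norm_mul, norm_sliceEmb]

/-- A function satisfying the slice Cauchy–Riemann equation is complex differentiable for the
complex structure induced by left multiplication by `I`. -/
theorem HoloSlice.differentiableAt_comp_sliceEmb {f : Quaternion ℝ → Quaternion ℝ}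
    {I : Quaternion ℝ} {U : Set (Quaternion ℝ)} (hf : HoloSlice f I U) (hI : I ∈ QSphere) {z : ℂ}
    (hz : sliceEmb I hI z ∈ U) :
    letI := sliceNormedSpace I hI
    DifferentiableAt ℂ (f ∘ sliceEmb I hI) z := by
  rw [sliceEmb_apply] at hz
  obtain ⟨hd, hcr⟩ := hf z.re z.im hz
  have hD := (hd.differentiableAt one_ne_zero).hasFDerivAt
  set D := fderiv ℝ (sliceMap f I) (z.re, z.im)
  have hy : D (0, 1) = I * D (1, 0) := by
    have h := congrArg (I * ·) hcr
    have hII : I * I = -1 := by rw [← sq]; exact hI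
    simp only [mul_add, ← mul_assoc, hII, mul_zero, neg_mul, one_mul] at h
    exact (add_neg_eq_zero.mp h).symm
  have hDw (w : ℂ) : D (w.re, w.im) = sliceEmb I hI w * D (1, 0) := by
    have hsplit : ((w.re, w.im) : ℝ × ℝ) = w.re • ((1, 0) : ℝ × ℝ) + w.im • ((0, 1) : ℝ × ℝ) := by
      simp
    rw [hsplit, map_add, map_smul, map_smul, hy, sliceEmb_apply, add_mul, mul_assoc,
      Quaternion.coe_mul_eq_smul, Quaternion.coe_mul_eq_smul]
  have hcomp : HasFDerivAt (f ∘ sliceEmb I hI)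
      (D.comp (Complex.equivRealProdCLM : ℂ →L[ℝ] ℝ × ℝ)) z := by
    have hfun : f ∘ sliceEmb I hI = sliceMap f I ∘ Complex.equivRealProdCLM := by
      funext w
      simp [sliceMap, sliceEmb_apply]
    rw [hfun]
    exact HasFDerivAt.comp z (by simpa using hD) Complex.equivRealProdCLM.hasFDerivAt
  rw [hasFDerivAt_iff_isLittleO] at hcomp
  let := sliceNormedSpace I hI
  refine HasDerivAt.differentiableAt (f' := D (1, 0)) ?_
  rw [hasDerivAt_iff_isLittleO]
  refine hcomp.congr_left fun w => ?_
  congr 1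
  exact hDw (w - z)

/-- The identity principle on a single slice. -/
theorem HoloSlice.eq_zero_of_accPt {f : Quaternion ℝ → Quaternion ℝ} {I : Quaternion ℝ}
    {U : Set (Quaternion ℝ)} (hf : HoloSlice f I U) (hI : I ∈ QSphere) (hU : IsOpen U)
    (hconn : IsPreconnected (U ∩ sliceL I)) {q₀ : Quaternion ℝ} (hq₀ : q₀ ∈ U ∩ sliceL I)
    (hacc : AccPt q₀ (𝓟 ({q ∈ U | f q = 0} ∩ sliceL I))) :
    ∀ q ∈ U ∩ sliceL I, f q = 0 := by
  let := sliceNormedSpace I hI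
  have hiso := isometry_sliceEmb hI
  have hopen : IsOpen (sliceEmb I hI ⁻¹' U) := hU.preimage hiso.continuous
  have han : AnalyticOnNhd ℂ (f ∘ sliceEmb I hI) (sliceEmb I hI ⁻¹' U) :=
    DifferentiableOn.analyticOnNhd
      (fun z hz => (hf.differentiableAt_comp_sliceEmb hI hz).differentiableWithinAt) hopen
  have hpre : IsPreconnected (sliceEmb I hI ⁻¹' U) := by
    rw [← hiso.isEmbedding.isInducing.isPreconnected_image, Set.image_preimage_eq_inter_range,
      range_sliceEmb]
    exact hconn
  obtain ⟨hq₀U, hq₀I⟩ := hq₀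
  rw [← range_sliceEmb hI] at hq₀I
  obtain ⟨z₀, rfl⟩ := hq₀I
  have hfreq : ∃ᶠ z in 𝓝[≠] z₀, (f ∘ sliceEmb I hI) z = 0 := by
    intro hev
    rw [eventually_nhdsWithin_iff, hiso.isEmbedding.isInducing.nhds_eq_comap,
      eventually_comap] at hev
    rw [accPt_iff_frequently] at hacc
    obtain ⟨q, ⟨hne, ⟨_, hq0⟩, hqI⟩, hq⟩ := (hacc.and_eventually hev).exists
    rw [← range_sliceEmb hI] at hqI
    obtain ⟨z, rfl⟩ := hqI
    exact hq z rfl (fun h => hne (congrArg _ h)) hq0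
  rintro q ⟨hqU, hqI⟩
  rw [← range_sliceEmb hI] at hqI
  obtain ⟨z, rfl⟩ := hqI
  exact han.eqOn_zero_of_preconnected_of_frequently_eq_zero hpre hq₀U hfreq hqU

theorem coe_mem_sliceL (x : ℝ) (I : Quaternion ℝ) : (x : Quaternion ℝ) ∈ sliceL I :=
  ⟨x, 0, by simp⟩

/-- Every quaternion lies in some slice. -/
theorem exists_mem_sliceL (q : Quaternion ℝ) : ∃ I ∈ QSphere, q ∈ sliceL I := by
  by_cases h : q.im = 0
  · have hJ : Quaternion.ofComplex Complex.I ^ 2 = -1 := by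
      rw [← map_pow, Complex.I_sq, map_neg, map_one]
    refine ⟨_, hJ, q.re, 0, ?_⟩
    rw [Quaternion.coe_zero, zero_mul, ← h, Quaternion.re_add_im]
  · have hn : ‖q.im‖ ≠ 0 := norm_ne_zero_iff.mpr h
    refine ⟨(‖q.im‖⁻¹ : ℝ) • q.im, ?_, q.re, ‖q.im‖, ?_⟩
    · change _ ^ 2 = _
      rw [smul_pow, Quaternion.im_sq, Quaternion.normSq_eq_norm_mul_self, ← sq, smul_neg,
        ← Quaternion.coe_smul, smul_eq_mul, ← mul_pow, inv_mul_cancel₀ hn]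
      simp
    · rw [Quaternion.coe_mul_eq_smul, smul_smul, mul_inv_cancel₀ hn, one_smul,
        Quaternion.re_add_im]

/-- A real point of an open set is an accumulation point of the real points of that set. -/
theorem accPt_coe_of_isOpen {U : Set (Quaternion ℝ)} (hU : IsOpen U) {x : ℝ}
    (hx : (x : Quaternion ℝ) ∈ U) :
    AccPt (x : Quaternion ℝ) (𝓟 (U ∩ Set.range ((↑) : ℝ → Quaternion ℝ))) := by
  rw [accPt_iff_frequently]
  have hcont : Tendsto ((↑) : ℝ → Quaternion ℝ) (𝓝[≠] x) (𝓝 (x : Quaternion ℝ)) :=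
    Quaternion.continuous_coe.continuousAt.mono_left nhdsWithin_le_nhds
  refine hcont.frequently (Eventually.frequently ?_)
  filter_upwards [hcont.eventually (hU.mem_nhds hx), self_mem_nhdsWithin] with y hy hne
  exact ⟨fun h => hne (Quaternion.coe_injective h), hy, y, rfl⟩

/-- Identity Principle: if a slice regular function `f` on a symmetric slice domain `Ω`
has a zero set whose intersection with some slice `Ω_I` admits an accumulation point in
`Ω_I`, then `f ≡ 0` on `Ω`. -/
theorem identity_principle
    (Ω : Set (Quaternion ℝ)) (hΩ : IsSymmSliceDomain Ω)
    (f : Quaternion ℝ → Quaternion ℝ) (hf : SliceRegularOn f Ω)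
    (hacc : ∃ I ∈ QSphere, ∃ z ∈ Ω ∩ sliceL I,
      AccPt z (Filter.principal ({q ∈ Ω | f q = 0} ∩ sliceL I))) :
    ∀ q ∈ Ω, f q = 0 := by

  obtain ⟨hopen, -, ⟨x, hx⟩, hconn, -⟩ := hΩ
  obtain ⟨I, hI, z, hz, hacc⟩ := hacc
  have hzero := (hf I hI).eq_zero_of_accPt hI hopen (hconn I hI).isPreconnected hz hacc
  intro q hq
  obtain ⟨J, hJ, hqJ⟩ := exists_mem_sliceL q
  refine (hf J hJ).eq_zero_of_accPt hJ hopen (hconn J hJ).isPreconnected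
    ⟨hx, coe_mem_sliceL x J⟩ ((accPt_coe_of_isOpen hopen hx).mono ?_) q ⟨hq, hqJ⟩
  rw [Filter.principal_mono]
  rintro _ ⟨hy, y, rfl⟩
  exact ⟨⟨hy, hzero _ ⟨hy, coe_mem_sliceL y I⟩⟩, coe_mem_sliceL y J⟩
end
end
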